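/- Let p be a large prime and d ≥ 2 an even integer. For all real s with 2 ≤ s ≤ (log p)/(log log log p): Σ over integers j with |j| ≤ s/π of α_d( 2s/(π(2j+1)) ) = (2s/π)·log s + Ĉ_d·s + O(log s), where Ĉ_d = (2/π)( γ + log(4/π) ) + (2/π)·∫₁^∞ (α_d(u) − u)/u² du and γ is the Euler–Mascheroni constant. -/

import Mathlib

open scoped BigOperators Classical

noncomputable section

/-- `α_d(u) = log((1/d) ∑_{k=0}^{d-1} exp(u cos(2kπ/d)))`. -/
def alphad (d : ℕ) (u : ℝ) : ℝ :=
  Real.log ((1 / d : ℝ) * ∑ k ∈ Finset.range d, Real.exp (u * Real.cos (2 * k * Real.pi / d)))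

/-- The constant `Ĉ_d` of Lemma 5.7. -/
def Cdhat (d : ℕ) : ℝ :=
  2 / Real.pi * (Real.eulerMascheroniConstant + Real.log (4 / Real.pi))
    + 2 / Real.pi * ∫ u in Set.Ioi (1:ℝ), (alphad d u - u) / u ^ 2

section alphad

variable {d : ℕ}

lemma alphad_mean_pos (hd : 0 < d) (u : ℝ) :
    0 < (1 / d : ℝ) * ∑ k ∈ Finset.range d, Real.exp (u * Real.cos (2 * k * Real.pi / d)) := by
  have hd' : (0 : ℝ) < d := by exact_mod_cast hd
  have : 0 < ∑ k ∈ Finset.range d, Real.exp (u * Real.cos (2 * k * Real.pi / d)) :=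
    Finset.sum_pos (fun _ _ => Real.exp_pos _) ⟨0, by simpa using hd⟩
  positivity

lemma continuous_alphad (hd : 0 < d) : Continuous (alphad d) := by
  unfold alphad
  refine Continuous.log (by fun_prop) fun u => (alphad_mean_pos hd u).ne'

/-- The function `α_d` is `1`-Lipschitz from above. -/
lemma alphad_sub_le (hd : 0 < d) {u v : ℝ} (huv : u ≤ v) :
    alphad d v - alphad d u ≤ v - u := by
  have hd' : (0 : ℝ) < d := by exact_mod_cast hd
  rw [sub_le_iff_le_add, alphad, Real.log_le_iff_le_exp (alphad_mean_pos hd v), Real.exp_add,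
    alphad, Real.exp_log (alphad_mean_pos hd u), mul_left_comm]
  gcongr
  rw [Finset.mul_sum]
  refine Finset.sum_le_sum fun k _ => ?_
  rw [← Real.exp_add, Real.exp_le_exp]
  nlinarith [Real.cos_le_one (2 * k * Real.pi / d)]

lemma alphad_zero (hd : 0 < d) : alphad d 0 = 0 := by
  have hd' : (0 : ℝ) < d := by exact_mod_cast hd
  simp [alphad, hd'.ne']

lemma alphad_le (hd : 0 < d) {u : ℝ} (hu : 0 ≤ u) : alphad d u ≤ u := by
  have := alphad_sub_le hd hu
  rw [alphad_zero hd] at this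
  linarith

lemma neg_le_alphad (hd : 0 < d) {u : ℝ} (hu : 0 ≤ u) : -u ≤ alphad d u := by
  have hd' : (0 : ℝ) < d := by exact_mod_cast hd
  rw [alphad, Real.le_log_iff_exp_le (alphad_mean_pos hd u), one_div, inv_mul_eq_div,
    le_div_iff₀ hd']
  have : ∑ _k ∈ Finset.range d, Real.exp (-u)
      ≤ ∑ k ∈ Finset.range d, Real.exp (u * Real.cos (2 * k * Real.pi / d)) := by
    refine Finset.sum_le_sum fun k _ => ?_
    rw [Real.exp_le_exp]
    nlinarith [Real.neg_one_le_cos (2 * k * Real.pi / d)]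
  simpa [mul_comm] using this

lemma alphad_neg (hd : Even d) (u : ℝ) : alphad d (-u) = alphad d u := by
  obtain ⟨m, rfl⟩ := hd
  rcases Nat.eq_zero_or_pos m with rfl | hm
  · simp [alphad]
  have hm' : (m : ℝ) ≠ 0 := by positivity
  have key : ∀ k : ℕ, Real.cos (2 * ((m + k : ℕ) : ℝ) * Real.pi / ((m + m : ℕ) : ℝ))
      = -Real.cos (2 * (k : ℝ) * Real.pi / ((m + m : ℕ) : ℝ)) := by
    intro k
    rw [← Real.cos_add_pi]
    congr 1
    push_cast
    field_simp
    ring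
  simp only [alphad, Finset.sum_range_add, key, neg_mul, mul_neg, neg_neg]
  congr 2
  exact add_comm _ _

/-- A lower bound for `α_d` which is uniform in `d`. -/
lemma le_alphad (hd : 0 < d) {u : ℝ} (hu : 1 / 2 ≤ u) :
    u - (5 / 2 + Real.log u / 2) ≤ alphad d u := by
  have hd' : (0 : ℝ) < d := by exact_mod_cast hd
  have hu0 : 0 < u := by linarith
  have hpi := Real.pi_gt_three
  set θ : ℝ := 1 / √u with hθ
  have hθ0 : 0 < θ := by positivity
  have hθsq : u * θ ^ 2 = 1 := by
    rw [hθ, div_pow, Real.sq_sqrt hu0.le]; field_simp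
  have hθlt : θ < 2 * Real.pi := by nlinarith
  set n : ℕ := ⌊d * θ / (2 * Real.pi)⌋₊ with hn
  have hn_le : (n : ℝ) ≤ d * θ / (2 * Real.pi) := Nat.floor_le (by positivity)
  have hn_lt : d * θ / (2 * Real.pi) < n + 1 := Nat.lt_floor_add_one _
  have hnd : n + 1 ≤ d := by
    have : d * θ / (2 * Real.pi) < d := by
      rw [div_lt_iff₀ (by positivity)]; gcongr
    have : (n : ℝ) < d := by linarith
    exact_mod_cast this
  have hlow : (n + 1) * Real.exp (u - 1 / 2)
      ≤ ∑ k ∈ Finset.range d, Real.exp (u * Real.cos (2 * k * Real.pi / d)) := by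
    calc (n + 1) * Real.exp (u - 1 / 2)
        = ∑ _k ∈ Finset.range (n + 1), Real.exp (u - 1 / 2) := by simp
      _ ≤ ∑ k ∈ Finset.range (n + 1), Real.exp (u * Real.cos (2 * k * Real.pi / d)) := by
        refine Finset.sum_le_sum fun k hk => ?_
        rw [Real.exp_le_exp]
        have hk : (k : ℝ) ≤ n := by
          exact_mod_cast Nat.lt_succ_iff.mp (Finset.mem_range.mp hk)
        have h1 : 2 * k * Real.pi / d ≤ θ := by
          rw [div_le_iff₀ hd']
          have := hk.trans hn_le
          rw [le_div_iff₀ (by positivity)] at this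
          linarith
        have h0 : 0 ≤ 2 * k * Real.pi / d := by positivity
        have hc := Real.one_sub_sq_div_two_le_cos (x := 2 * k * Real.pi / d)
        have : (2 * k * Real.pi / d) ^ 2 ≤ θ ^ 2 := by gcongr
        nlinarith
      _ ≤ _ := Finset.sum_le_sum_of_subset_of_nonneg (by simpa using hnd)
        fun _ _ _ => (Real.exp_pos _).le
  have hmain : θ / (2 * Real.pi) * Real.exp (u - 1 / 2)
      ≤ (1 / d : ℝ) * ∑ k ∈ Finset.range d, Real.exp (u * Real.cos (2 * k * Real.pi / d)) := by
    rw [one_div_mul_eq_div, le_div_iff₀ hd']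
    refine le_trans ?_ hlow
    rw [mul_right_comm]
    gcongr
    rw [div_mul_eq_mul_div, mul_comm θ]
    exact hn_lt.le
  have hlog := Real.log_le_log (by positivity) hmain
  rw [Real.log_mul (by positivity) (by positivity), Real.log_exp,
    Real.log_div (by positivity) (by positivity), hθ, one_div, Real.log_inv,
    Real.log_sqrt hu0.le] at hlog
  have h2pi : Real.log (2 * Real.pi) ≤ 2 := by
    rw [Real.log_le_iff_le_exp (by positivity)]
    have he : Real.exp 2 = Real.exp 1 * Real.exp 1 := by rw [← Real.exp_add]; norm_num
    rw [he]
    nlinarith [Real.exp_one_gt_d9, Real.pi_lt_d2]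
  unfold alphad
  linarith

end alphad

lemma sum_Icc_neg_eq {f : ℤ → ℝ} (hf : ∀ j, f (-1 - j) = f j) (n : ℕ) :
    ∑ j ∈ Finset.Icc (-(n : ℤ)) n, f j = 2 * ∑ j ∈ Finset.range n, f j + f n := by
  induction n with
  | zero => simp
  | succ n ih =>
    rw [Nat.cast_add, Nat.cast_one, Finset.Icc_succ_succ, Finset.sum_union (by simp),
      Finset.sum_pair (by lia), ih, Finset.sum_range_succ,
      show -((n : ℤ) + 1) = -1 - n by ring, hf]
    ring

lemma Icc_filter_abs_le {x : ℝ} (hx : 0 ≤ x) :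
    (Finset.Icc (-(⌈x⌉₊ : ℤ)) (⌈x⌉₊ : ℤ)).filter (fun j : ℤ => |(j : ℝ)| ≤ x)
      = Finset.Icc (-(⌊x⌋₊ : ℤ)) ⌊x⌋₊ := by
  ext j
  have h1 : |(j : ℝ)| ≤ x ↔ |j| ≤ (⌊x⌋₊ : ℤ) := by
    rw [Int.natCast_floor_eq_floor hx, Int.le_floor]
    simp
  have h2 : (⌊x⌋₊ : ℤ) ≤ ⌈x⌉₊ := by exact_mod_cast Nat.floor_le_ceil x
  rw [Finset.mem_filter, h1, abs_le, Finset.mem_Icc, Finset.mem_Icc]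
  lia

lemma abs_harmonic_sub_le {n : ℕ} (hn : 0 < n) :
    |(harmonic n : ℝ) - Real.log n - Real.eulerMascheroniConstant| ≤ 1 / n := by
  have hn' : (0 : ℝ) < n := by exact_mod_cast hn
  have h1 := Real.eulerMascheroniSeq_lt_eulerMascheroniConstant n
  have h2 := Real.eulerMascheroniConstant_lt_eulerMascheroniSeq' n
  rw [Real.eulerMascheroniSeq] at h1
  rw [Real.eulerMascheroniSeq', if_neg hn.ne'] at h2
  have h3 : Real.log (n + 1) - Real.log n ≤ 1 / n := by
    rw [← Real.log_div (by positivity) (by positivity)]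
    refine (Real.log_le_sub_one_of_pos (by positivity)).trans_eq ?_
    field_simp
    ring
  rw [abs_le]
  constructor <;> linarith [show (0 : ℝ) ≤ 1 / n by positivity]

lemma sum_one_div_odd (n : ℕ) :
    ∑ j ∈ Finset.range n, 1 / (2 * (j : ℝ) + 1) = harmonic (2 * n) - harmonic n / 2 := by
  induction n with
  | zero => simp
  | succ n ih =>
    rw [Finset.sum_range_succ, ih, show 2 * (n + 1) = 2 * n + 1 + 1 by ring, harmonic_succ,
      harmonic_succ, harmonic_succ]
    push_cast
    field_simp
    ring

lemma abs_sum_one_div_odd_sub_le {n : ℕ} (hn : 0 < n) :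
    |∑ j ∈ Finset.range n, 1 / (2 * (j : ℝ) + 1)
      - (Real.log 4 + Real.log n + Real.eulerMascheroniConstant) / 2| ≤ 1 / n := by
  have hn' : (0 : ℝ) < n := by exact_mod_cast hn
  have h1 := abs_le.mp (abs_harmonic_sub_le (show 0 < 2 * n by positivity))
  have h2 := abs_le.mp (abs_harmonic_sub_le hn)
  have h4 : Real.log 4 = 2 * Real.log 2 := by
    rw [show (4 : ℝ) = 2 ^ 2 by norm_num, Real.log_pow]; norm_num
  push_cast at h1
  rw [Real.log_mul two_ne_zero hn'.ne', show 1 / (2 * (n : ℝ)) = 1 / n / 2 by field_simp] at h1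
  rw [sum_one_div_odd, h4, abs_le]
  constructor <;> linarith [h1.1, h1.2, h2.1, h2.2]

lemma abs_mul_sum_one_div_odd_sub_le {x : ℝ} (hx : 1 / 2 ≤ x) :
    |4 * x * ∑ j ∈ Finset.range ⌊x⌋₊, 1 / (2 * (j : ℝ) + 1)
      - 2 * x * (Real.log 4 + Real.log x + Real.eulerMascheroniConstant)| ≤ 12 := by
  have hγ := Real.one_half_lt_eulerMascheroniConstant
  have hγ' := Real.eulerMascheroniConstant_lt_two_thirds
  have hx0 : 0 < x := by linarith
  have hle := Nat.floor_le hx0.le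
  have hlt := Nat.lt_floor_add_one x
  rcases Nat.eq_zero_or_pos ⌊x⌋₊ with h0 | hpos
  · rw [h0] at hlt
    rw [h0, abs_le]
    have h4 : Real.log 4 = 2 * Real.log 2 := by
      rw [show (4 : ℝ) = 2 ^ 2 by norm_num, Real.log_pow]; norm_num
    have h2 := Real.log_two_lt_d9
    have h2' := Real.log_two_gt_d9
    have hx1 : Real.log x ≤ 0 := Real.log_nonpos hx0.le (by simpa using hlt.le)
    have hx2 : -Real.log 2 ≤ Real.log x := by
      rw [← Real.log_inv]
      exact Real.log_le_log (by norm_num) (by linarith)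
    have hx3 : x ≤ 1 := by simpa using hlt.le
    simp only [Finset.range_zero, Finset.sum_empty]
    constructor <;> nlinarith
  · generalize hn : ⌊x⌋₊ = n at *
    have hn1 : (1 : ℝ) ≤ n := by exact_mod_cast hpos
    have h1 := abs_le.mp (abs_sum_one_div_odd_sub_le hpos)
    have h2 : Real.log n ≤ Real.log x := Real.log_le_log (by positivity) hle
    have h3 : Real.log x - Real.log n ≤ 1 / n := by
      rw [← Real.log_div (by positivity) (by positivity)]
      refine (Real.log_le_sub_one_of_pos (by positivity)).trans ?_
      rw [sub_le_iff_le_add, div_add_one (by positivity)]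
      gcongr
      linarith
    have h4 : x * (1 / n) ≤ 2 := by
      rw [mul_one_div, div_le_iff₀ (by positivity)]; linarith
    rw [abs_le]
    constructor <;> nlinarith

section integralComparison

open MeasureTheory Set Filter Topology

lemma five_halves_add_log_nonneg {u : ℝ} (hu : 1 / 2 ≤ u) : 0 ≤ 5 / 2 + Real.log u / 2 := by
  have h1 : -Real.log 2 ≤ Real.log u := by
    rw [← Real.log_inv]
    exact Real.log_le_log (by norm_num) (by linarith)
  linarith [Real.log_two_lt_d9]

lemma hasDerivAt_three_add_log_div {u : ℝ} (hu : 0 < u) :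
    HasDerivAt (fun v => -((3 + Real.log v / 2) / v)) ((5 / 2 + Real.log u / 2) / u ^ 2) u := by
  have h := ((((Real.hasDerivAt_log hu.ne').div_const 2).const_add 3).div
    (hasDerivAt_id u) hu.ne').neg
  refine h.congr_deriv ?_
  simp only [id]
  field_simp
  ring

lemma tendsto_three_add_log_div :
    Tendsto (fun v : ℝ => -((3 + Real.log v / 2) / v)) atTop (𝓝 0) := by
  have h1 : Tendsto (fun v : ℝ => Real.log v / v) atTop (𝓝 0) := by
    simpa using Real.tendsto_pow_log_div_mul_add_atTop 1 0 1 one_ne_zero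
  have h2 : Tendsto (fun v : ℝ => v⁻¹) atTop (𝓝 0) := tendsto_inv_atTop_zero
  have h3 := ((h2.const_mul 3).add (h1.const_mul (1 / 2))).neg
  simp only [mul_zero, add_zero, neg_zero] at h3
  refine h3.congr fun v => ?_
  ring

lemma integrableOn_log_div_sq {t : ℝ} (ht : 1 / 2 ≤ t) :
    IntegrableOn (fun u : ℝ => (5 / 2 + Real.log u / 2) / u ^ 2) (Ioi t) :=
  integrableOn_Ioi_deriv_of_nonneg'
    (fun u hu => hasDerivAt_three_add_log_div (by have := mem_Ici.mp hu; linarith))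
    (fun u hu => div_nonneg
      (five_halves_add_log_nonneg (by have := mem_Ioi.mp hu; linarith)) (sq_nonneg u))
    tendsto_three_add_log_div

lemma integral_log_div_sq {t : ℝ} (ht : 1 / 2 ≤ t) :
    ∫ u in Ioi t, (5 / 2 + Real.log u / 2) / u ^ 2 = (3 + Real.log t / 2) / t := by
  rw [integral_Ioi_of_hasDerivAt_of_nonneg'
    (fun u hu => hasDerivAt_three_add_log_div (by have := mem_Ici.mp hu; linarith))
    (fun u hu => div_nonneg
      (five_halves_add_log_nonneg (by have := mem_Ioi.mp hu; linarith)) (sq_nonneg u))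
    tendsto_three_add_log_div]
  ring

variable {h : ℝ → ℝ}

lemma integrableOn_div_sq (hc : Continuous h) (hneg : ∀ u, 0 ≤ u → h u ≤ 0)
    (hlow : ∀ u, 1 / 2 ≤ u → -(5 / 2 + Real.log u / 2) ≤ h u) {t : ℝ} (ht : 1 / 2 ≤ t) :
    IntegrableOn (fun u => h u / u ^ 2) (Ioi t) := by
  refine Integrable.mono' (integrableOn_log_div_sq ht)
    (hc.measurable.div (by fun_prop)).aestronglyMeasurable ?_
  filter_upwards [ae_restrict_mem measurableSet_Ioi] with u hu
  have hu' : 1 / 2 ≤ u := ht.trans (mem_Ioi.mp hu).le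
  rw [Real.norm_eq_abs, abs_div, abs_of_nonneg (sq_nonneg u),
    abs_of_nonpos (hneg u (by linarith))]
  gcongr
  linarith [hlow u hu']

lemma neg_le_integral_div_sq (hc : Continuous h) (hneg : ∀ u, 0 ≤ u → h u ≤ 0)
    (hlow : ∀ u, 1 / 2 ≤ u → -(5 / 2 + Real.log u / 2) ≤ h u) {t : ℝ} (ht : 1 / 2 ≤ t) :
    -((3 + Real.log t / 2) / t) ≤ ∫ u in Ioi t, h u / u ^ 2 := by
  rw [← integral_log_div_sq ht, ← integral_neg]
  refine setIntegral_mono_on (integrableOn_log_div_sq ht).neg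
    (integrableOn_div_sq hc hneg hlow ht) measurableSet_Ioi fun u hu => ?_
  rw [← neg_div]
  gcongr
  exact hlow u (ht.trans (mem_Ioi.mp hu).le)

lemma integral_div_sq_nonpos (hneg : ∀ u, 0 ≤ u → h u ≤ 0) {t : ℝ} (ht : 0 ≤ t) :
    ∫ u in Ioi t, h u / u ^ 2 ≤ 0 :=
  setIntegral_nonpos measurableSet_Ioi fun u hu =>
    div_nonpos_of_nonpos_of_nonneg (hneg u (ht.trans (mem_Ioi.mp hu).le)) (sq_nonneg u)

lemma intervalIntegrable_div_sq (hc : Continuous h) {t r : ℝ} (ht : 0 < t) (htr : t ≤ r) :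
    IntervalIntegrable (fun u => h u / u ^ 2) volume t r := by
  refine ContinuousOn.intervalIntegrable ?_
  rw [uIcc_of_le htr]
  refine hc.continuousOn.div (by fun_prop) fun u hu => ?_
  have : 0 < u := ht.trans_le hu.1
  positivity

lemma integral_const_div_sq (c : ℝ) {t r : ℝ} (ht : 0 < t) (htr : t ≤ r) :
    ∫ u in t..r, c / u ^ 2 = (1 / t - 1 / r) * c := by
  have hd : ∀ u ∈ uIcc t r, HasDerivAt (fun v : ℝ => -(c * v⁻¹)) (c / u ^ 2) u := by
    intro u hu
    rw [uIcc_of_le htr] at hu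
    have hu0 : u ≠ 0 := (ht.trans_le hu.1).ne'
    refine (((hasDerivAt_inv hu0).const_mul c).neg).congr_deriv ?_
    field_simp
  rw [intervalIntegral.integral_eq_sub_of_hasDerivAt hd
    (intervalIntegrable_div_sq continuous_const ht htr)]
  ring

lemma integral_Ioi_div_sq_sub_mem (hc : Continuous h) (ha : Antitone h)
    (hneg : ∀ u, 0 ≤ u → h u ≤ 0)
    (hlow : ∀ u, 1 / 2 ≤ u → -(5 / 2 + Real.log u / 2) ≤ h u) {t r : ℝ} (ht : 1 / 2 ≤ t)
    (htr : t ≤ r) :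
    (∫ u in Ioi t, h u / u ^ 2) - ∫ u in Ioi r, h u / u ^ 2 ∈
      Icc ((1 / t - 1 / r) * h r) ((1 / t - 1 / r) * h t) := by
  have ht0 : 0 < t := by linarith
  rw [intervalIntegral.integral_Ioi_sub_Ioi (integrableOn_div_sq hc hneg hlow ht) htr,
    ← integral_const_div_sq _ ht0 htr, ← integral_const_div_sq _ ht0 htr]
  constructor
  · refine intervalIntegral.integral_mono_on htr (intervalIntegrable_div_sq continuous_const ht0 htr)
      (intervalIntegrable_div_sq hc ht0 htr) fun u hu => ?_
    gcongr
    exact ha hu.2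
  · refine intervalIntegral.integral_mono_on htr (intervalIntegrable_div_sq hc ht0 htr)
      (intervalIntegrable_div_sq continuous_const ht0 htr) fun u hu => ?_
    gcongr
    exact ha hu.1

/-- Comparison of a midpoint sum of `y ↦ h (x / y)` with its integral, written in the
variable `u = x / y`. -/
lemma abs_sum_sub_integral_div_sq_le (hc : Continuous h) (ha : Antitone h)
    (hneg : ∀ u, 0 ≤ u → h u ≤ 0)
    (hlow : ∀ u, 1 / 2 ≤ u → -(5 / 2 + Real.log u / 2) ≤ h u) {x : ℝ} (hx : 1 / 2 ≤ x) :
    |∑ j ∈ Finset.range ⌊x⌋₊, h (2 * x / (2 * (j : ℝ) + 1)) - x * ∫ u in Ioi 1, h u / u ^ 2|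
      ≤ 3 + Real.log (2 * x) / 2 := by
  have hx0 : 0 < x := by linarith
  have hle := Nat.floor_le hx0.le
  have hlt := Nat.lt_floor_add_one x
  have hlog : 0 ≤ Real.log (2 * x) := Real.log_nonneg (by linarith)
  set F : ℝ → ℝ := fun y => x * ∫ u in Ioi (x / y), h u / u ^ 2 with hF
  have hF1 : x * ∫ u in Ioi 1, h u / u ^ 2 = F x := by simp only [hF, div_self hx0.ne']
  have hFsub : ∀ a b, 0 < a → a ≤ b → b ≤ 2 * x →
      F b - F a ∈ Icc ((b - a) * h (x / a)) ((b - a) * h (x / b)) := by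
    intro a b ha0 hab hb
    have hb0 : 0 < b := ha0.trans_le hab
    have ht : 1 / 2 ≤ x / b := by rw [div_le_div_iff₀ (by norm_num) hb0]; linarith
    have hmem := integral_Ioi_div_sq_sub_mem hc ha hneg hlow ht
      (div_le_div_of_nonneg_left hx0.le ha0 hab)
    have hwidth : x * (1 / (x / b) - 1 / (x / a)) = b - a := by field_simp
    rw [hF, ← hwidth, mul_assoc, mul_assoc, ← mul_sub]
    exact ⟨mul_le_mul_of_nonneg_left hmem.1 hx0.le, mul_le_mul_of_nonneg_left hmem.2 hx0.le⟩
  have hFneg : ∀ y, 0 < y → F y ≤ 0 := fun y hy =>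
    mul_nonpos_of_nonneg_of_nonpos hx0.le (integral_div_sq_nonpos hneg (by positivity))
  have hFhalf : -(3 / 2 + Real.log (2 * x) / 4) ≤ F (1 / 2) := by
    have h1 := neg_le_integral_div_sq hc hneg hlow (t := 2 * x) (by linarith)
    have h2 := mul_le_mul_of_nonneg_left h1 hx0.le
    have h3 : x * -((3 + Real.log (2 * x) / 2) / (2 * x)) = -(3 / 2 + Real.log (2 * x) / 4) := by
      field_simp
      ring
    rw [h3] at h2
    simpa only [hF, show x / (1 / 2) = 2 * x by ring] using h2
  have hterm : ∀ j : ℕ, 2 * x / (2 * (j : ℝ) + 1) = x / (j + 1 / 2) := by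
    intro j
    field_simp
  simp only [hterm]
  rw [hF1]
  generalize hn : ⌊x⌋₊ = n at *
  have hupper : ∑ j ∈ Finset.range n, h (x / ((j : ℝ) + 1 / 2)) ≤ F (n + 1 / 2) - F (1 / 2) := by
    have hsum := Finset.sum_range_sub (fun j : ℕ => F (j + 1 / 2)) n
    simp only [Nat.cast_zero, zero_add] at hsum
    rw [← hsum]
    refine Finset.sum_le_sum fun j hj => ?_
    have hj' : ((j + 1 : ℕ) : ℝ) ≤ n := by exact_mod_cast Finset.mem_range.mp hj
    have hmem := (hFsub (j + 1 / 2) ((j + 1 : ℕ) + 1 / 2) (by positivity)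
      (by push_cast; linarith) (by linarith)).1
    refine le_trans (le_of_eq ?_) hmem
    push_cast
    ring
  have hlower : h (2 * x) + F x ≤ ∑ j ∈ Finset.range n, h (x / ((j : ℝ) + 1 / 2)) := by
    rcases n with _ | m
    · simpa using add_nonpos (hneg (2 * x) (by positivity)) (hFneg x hx0)
    · push_cast at hle hlt
      have hm : F (m + 1 / 2) - F (1 / 2)
          ≤ ∑ j ∈ Finset.range m, h (x / (((j + 1 : ℕ) : ℝ) + 1 / 2)) := by
        have hsum := Finset.sum_range_sub (fun j : ℕ => F (j + 1 / 2)) m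
        simp only [Nat.cast_zero, zero_add] at hsum
        rw [← hsum]
        refine Finset.sum_le_sum fun j hj => ?_
        have hj' : ((j + 1 : ℕ) : ℝ) ≤ m := by exact_mod_cast Finset.mem_range.mp hj
        have hmem := (hFsub (j + 1 / 2) ((j + 1 : ℕ) + 1 / 2) (by positivity)
          (by push_cast; linarith) (by linarith)).2
        refine hmem.trans (le_of_eq ?_)
        push_cast
        ring
      have hmx := (hFsub (m + 1 / 2) x (by positivity) (by linarith) (by linarith)).2
      have hnonpos : (x - (m + 1 / 2)) * h (x / x) ≤ 0 :=
        mul_nonpos_of_nonneg_of_nonpos (by linarith) (hneg _ (by positivity))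
      rw [Finset.sum_range_succ', Nat.cast_zero, zero_add, show x / (1 / 2) = 2 * x by ring]
      linarith [hFneg (1 / 2) (by norm_num)]
  have hend : F (n + 1 / 2) ≤ F x + 3 / 2 := by
    rcases le_total x (n + 1 / 2) with hxn | hxn
    · have h1 := (hFsub x (n + 1 / 2) hx0 hxn (by linarith)).2
      have h2 : ((n + 1 / 2 : ℝ) - x) * h (x / (n + 1 / 2)) ≤ 0 :=
        mul_nonpos_of_nonneg_of_nonpos (by linarith) (hneg _ (by positivity))
      linarith
    · have h1 := (hFsub (n + 1 / 2) x (by positivity) hxn (by linarith)).1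
      set v : ℝ := x / (n + 1 / 2) with hv
      have hv1 : 1 ≤ v := by rw [hv, one_le_div (by positivity)]; exact hxn
      have hv2 : v ≤ 2 := by rw [hv, div_le_iff₀ (by positivity)]; linarith
      have h2 := hlow v (by linarith)
      have h3 : Real.log v ≤ v - 1 := Real.log_le_sub_one_of_pos (by linarith)
      have h4 : -3 ≤ h v := by linarith
      have h5 : h v ≤ 0 := hneg v (by linarith)
      nlinarith
  have h2x := hlow (2 * x) (by linarith)
  rw [abs_le]
  constructor <;> linarith

end integralComparison

lemma abs_sum_alphad_sub_le {d : ℕ} (hd : 0 < d) (hde : Even d) {s : ℝ} (hs : 2 ≤ s) :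
    |∑ j ∈ (Finset.Icc (-(⌈s / Real.pi⌉₊ : ℤ)) (⌈s / Real.pi⌉₊ : ℤ)).filter
        (fun j : ℤ => |(j : ℝ)| ≤ s / Real.pi), alphad d (2 * s / (Real.pi * (2 * (j : ℝ) + 1)))
      - (2 * s / Real.pi * Real.log s + Cdhat d * s)| ≤ 20 + Real.log s := by
  have hpi := Real.pi_pos
  have hpi4 := Real.pi_le_four
  have hs0 : 0 < s := by linarith
  have hx : 1 / 2 ≤ s / Real.pi := by rw [div_le_div_iff₀ (by norm_num) hpi]; linarith
  rw [Icc_filter_abs_le (by positivity), sum_Icc_neg_eq]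
  swap
  · intro j
    rw [← alphad_neg hde]
    congr 1
    rw [← div_neg]
    push_cast
    ring_nf
  have hmain : 2 * s / Real.pi * Real.log s + Cdhat d * s
      = 2 * (s / Real.pi)
          * (Real.log 4 + Real.log (s / Real.pi) + Real.eulerMascheroniConstant)
        + 2 * (s / Real.pi * ∫ u in Set.Ioi (1 : ℝ), (alphad d u - u) / u ^ 2) := by
    rw [Cdhat, Real.log_div (by norm_num) hpi.ne', Real.log_div hs0.ne' hpi.ne']
    ring
  have harg : ∀ y : ℝ, 2 * s / (Real.pi * y) = 2 * (s / Real.pi) / y := by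
    intro y
    rw [← div_div, mul_div_assoc]
  rw [hmain]
  simp only [harg, Int.cast_natCast]
  have hxs : Real.log (2 * (s / Real.pi)) ≤ Real.log s := by
    refine Real.log_le_log (by positivity) ?_
    rw [← mul_div_assoc, div_le_iff₀ hpi]
    nlinarith [Real.pi_gt_three]
  generalize s / Real.pi = x at *
  have hx0 : 0 < x := by linarith
  have hlt := Nat.lt_floor_add_one x
  have h1 := abs_le.mp (abs_mul_sum_one_div_odd_sub_le hx)
  have h2 := abs_le.mp (abs_sum_sub_integral_div_sq_le (h := fun u => alphad d u - u)
    ((continuous_alphad hd).sub continuous_id)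
    (fun u v huv => by linarith [alphad_sub_le hd huv])
    (fun u hu => by linarith [alphad_le hd hu])
    (fun u hu => by linarith [le_alphad hd hu]) hx)
  have hsplit : 2 * ∑ j ∈ Finset.range ⌊x⌋₊, alphad d (2 * x / (2 * (j : ℝ) + 1))
      = 4 * x * ∑ j ∈ Finset.range ⌊x⌋₊, 1 / (2 * (j : ℝ) + 1)
        + 2 * ∑ j ∈ Finset.range ⌊x⌋₊,
            (alphad d (2 * x / (2 * (j : ℝ) + 1)) - 2 * x / (2 * (j : ℝ) + 1)) := by
    rw [Finset.sum_sub_distrib, Finset.mul_sum (a := 4 * x), mul_sub]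
    have : ∑ j ∈ Finset.range ⌊x⌋₊, 4 * x * (1 / (2 * (j : ℝ) + 1))
        = 2 * ∑ j ∈ Finset.range ⌊x⌋₊, 2 * x / (2 * (j : ℝ) + 1) := by
      rw [Finset.mul_sum]
      exact Finset.sum_congr rfl fun j _ => by ring
    linarith
  have hlast : 2 * x / (2 * (⌊x⌋₊ : ℝ) + 1) ≤ 2 := by
    rw [div_le_iff₀ (by positivity)]
    linarith [(Nat.cast_nonneg ⌊x⌋₊ : (0 : ℝ) ≤ _)]
  have hlast0 : 0 ≤ 2 * x / (2 * (⌊x⌋₊ : ℝ) + 1) := by positivity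
  have h3 := alphad_le hd hlast0
  have h4 := neg_le_alphad hd hlast0
  rw [hsplit, abs_le]
  constructor <;> linarith [h1.1, h1.2, h2.1, h2.2]

/-- Lemma 5.7: for even `d ≥ 2`, large primes `p` and `2 ≤ s ≤ (log p)/(log log log p)`,
`∑_{|j| ≤ s/π} α_d(2s/(π(2j+1))) = (2s/π) log s + Ĉ_d s + O(log s)`. -/
theorem head_sum_estimate :
    ∃ C > 0, ∃ p₀ : ℕ, ∀ p : ℕ, p.Prime → p₀ ≤ p →
      ∀ d : ℕ, 2 ≤ d → Even d →
      ∀ s : ℝ, 2 ≤ s → s ≤ Real.log p / Real.log (Real.log (Real.log p)) →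
        |Finset.sum
            ((Finset.Icc (-(⌈s / Real.pi⌉₊ : ℤ)) ((⌈s / Real.pi⌉₊ : ℤ))).filter
              (fun j : ℤ => |(j : ℝ)| ≤ s / Real.pi))
            (fun j : ℤ => alphad d (2 * s / (Real.pi * (2 * (j : ℝ) + 1))))
          - (2 * s / Real.pi * Real.log s + Cdhat d * s)| ≤ C * Real.log s := by
  refine ⟨41, by norm_num, 0, fun p _ _ d hd hde s hs _ => ?_⟩
  refine (abs_sum_alphad_sub_le (by lia) hde hs).trans ?_
  have h := Real.log_le_log two_pos hs
  linarith [Real.log_two_gt_d9]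

end
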